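/- arXiv:2302.07178 — 10 statements merged into one kernel-verified Lean document; each statement's English description precedes it below -/
import Mathlib

section
/- Let (g,·,∗) be a compatible pre-Lie algebra over a field K. Define brackets [x,y] = x·y − y·x and {x,y} = x∗y − y∗x. Then [·,·] and {·,·} are Lie brackets on g and satisfy [{x,y},z] + [{y,z},x] + [{z,x},y] + {[x,y],z} + {[y,z],x} + {[z,x],y} = 0 for all x,y,z ∈ g; that is, (g,[·,·],{·,·}) is a compatible Lie algebra (the sub-adjacent compatible Lie algebra). -/
variable {K : Type*} [Field K]
variable {g : Type*} [AddCommGroup g] [Module K g]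
variable {V : Type*} [AddCommGroup V] [Module K V]

/-- A bilinear product is pre-Lie if its associator is symmetric in the first
two arguments. -/
def IsPreLie (π : g →ₗ[K] g →ₗ[K] g) : Prop :=
  ∀ x y z : g, π (π x y) z - π x (π y z) = π (π y x) z - π y (π x z)

/-- The compatibility condition between two pre-Lie products. -/
def IsCompatPair (π₁ π₂ : g →ₗ[K] g →ₗ[K] g) : Prop :=
  ∀ x y z : g,
    π₁ (π₂ x y) z + π₂ (π₁ x y) z - π₁ x (π₂ y z) - π₂ x (π₁ y z)
      - π₁ (π₂ y x) z - π₂ (π₁ y x) z + π₁ y (π₂ x z) + π₂ y (π₁ x z) = 0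

/-- The commutator bracket of a bilinear product. -/
def commBr (π : g →ₗ[K] g →ₗ[K] g) (x y : g) : g := π x y - π y x

theorem commBr_skew (π : g →ₗ[K] g →ₗ[K] g) (x y : g) : commBr π x y = -commBr π y x :=
  (neg_sub _ _).symm

theorem IsPreLie.commBr_jacobi {π : g →ₗ[K] g →ₗ[K] g} (h : IsPreLie π) (x y z : g) :
    commBr π (commBr π x y) z + commBr π (commBr π y z) x + commBr π (commBr π z x) y = 0 := by
  simp only [commBr, map_sub, LinearMap.sub_apply]
  linear_combination (norm := abel) h x y z + h y z x + h z x y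

theorem IsCompatPair.commBr_jacobi {π₁ π₂ : g →ₗ[K] g →ₗ[K] g} (h : IsCompatPair π₁ π₂)
    (x y z : g) :
    commBr π₁ (commBr π₂ x y) z + commBr π₁ (commBr π₂ y z) x + commBr π₁ (commBr π₂ z x) y
      + commBr π₂ (commBr π₁ x y) z + commBr π₂ (commBr π₁ y z) x
      + commBr π₂ (commBr π₁ z x) y = 0 := by
  simp only [commBr, map_sub, LinearMap.sub_apply]
  linear_combination (norm := abel) h x y z + h y z x + h z x y

/-- the commutator brackets of a compatible pre-Lie algebra form a
compatible Lie algebra. -/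
theorem subadjacent_compatible_Lie
    (π₁ π₂ : g →ₗ[K] g →ₗ[K] g)
    (h₁ : IsPreLie π₁) (h₂ : IsPreLie π₂) (h₃ : IsCompatPair π₁ π₂) :
    (∀ x y : g, commBr π₁ x y = -commBr π₁ y x) ∧
    (∀ x y z : g,
      commBr π₁ (commBr π₁ x y) z + commBr π₁ (commBr π₁ y z) x
        + commBr π₁ (commBr π₁ z x) y = 0) ∧
    (∀ x y : g, commBr π₂ x y = -commBr π₂ y x) ∧
    (∀ x y z : g,
      commBr π₂ (commBr π₂ x y) z + commBr π₂ (commBr π₂ y z) x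
        + commBr π₂ (commBr π₂ z x) y = 0) ∧
    (∀ x y z : g,
      commBr π₁ (commBr π₂ x y) z + commBr π₁ (commBr π₂ y z) x + commBr π₁ (commBr π₂ z x) y
        + commBr π₂ (commBr π₁ x y) z + commBr π₂ (commBr π₁ y z) x
        + commBr π₂ (commBr π₁ z x) y = 0) :=
  ⟨commBr_skew π₁, h₁.commBr_jacobi, commBr_skew π₂, h₂.commBr_jacobi, h₃.commBr_jacobi⟩
end

section
/- Let (V,ρ,μ,ρ̃,μ̃) be a representation of a compatible pre-Lie algebra (g,·,∗) over a field K, and let (g,[·,·],{·,·}) be the sub-adjacent compatible Lie algebra, where [x,y] = x·y − y·x and {x,y} = x∗y − y∗x. Then (V, ρ−μ, ρ̃−μ̃) is a representation of the compatible Lie algebra (g,[·,·],{·,·}): ρ−μ is a Lie algebra representation of (g,[·,·]), ρ̃−μ̃ is a Lie algebra representation of (g,{·,·}), and (ρ−μ)({x,y}) + (ρ̃−μ̃)([x,y]) = [(ρ−μ)(x),(ρ̃−μ̃)(y)] − [(ρ−μ)(y),(ρ̃−μ̃)(x)] for all x,y ∈ g, where [A,B] = AB − BA in End(V). -/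
variable {K : Type*} [Field K]
variable {g : Type*} [AddCommGroup g] [Module K g]
variable {V : Type*} [AddCommGroup V] [Module K V]

/-- A representation (ρ,μ) of a pre-Lie algebra (g,π) on V. -/
def IsPreLieRep (π : g →ₗ[K] g →ₗ[K] g)
    (ρ μ : g →ₗ[K] Module.End K V) : Prop :=
  (∀ x y : g, ρ (π x y - π y x) = ρ x * ρ y - ρ y * ρ x) ∧
  (∀ x y : g, μ y * μ x - μ (π x y) = μ y * ρ x - ρ x * μ y)

/-- A representation (ρ,μ,ρt,μt) of a compatible pre-Lie algebra (g,π₁,π₂) on V. -/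
def IsCompatRep (π₁ π₂ : g →ₗ[K] g →ₗ[K] g)
    (ρ μ ρt μt : g →ₗ[K] Module.End K V) : Prop :=
  IsPreLieRep π₁ ρ μ ∧ IsPreLieRep π₂ ρt μt ∧
  (∀ x y : g, ρ (π₂ x y) + ρt (π₁ x y) - ρ x * ρt y - ρt x * ρ y
      = ρ (π₂ y x) + ρt (π₁ y x) - ρ y * ρt x - ρt y * ρ x) ∧
  (∀ x y : g, μ y * ρt x - ρ x * μt y - μ y * μt x + μ (π₂ x y)
      = -(μt y * ρ x) + ρt x * μ y + μt y * μ x - μt (π₁ x y))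

/-- If (ρ,μ) represents a pre-Lie algebra, then ρ - μ represents its
sub-adjacent Lie algebra. -/
theorem IsPreLieRep.sub_map_commutator {π : g →ₗ[K] g →ₗ[K] g}
    {ρ μ : g →ₗ[K] Module.End K V} (h : IsPreLieRep π ρ μ) (x y : g) :
    (ρ - μ) (π x y - π y x)
      = (ρ - μ) x * (ρ - μ) y - (ρ - μ) y * (ρ - μ) x := by
  have hxy := sub_eq_iff_eq_add.mp (h.2 x y)
  have hyx := sub_eq_iff_eq_add.mp (h.2 y x)
  rw [LinearMap.sub_apply, h.1, map_sub]
  simp only [LinearMap.sub_apply, sub_mul, mul_sub, hxy, hyx]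
  abel

/-- (ρ−μ, ρt−μt) is a representation of the sub-adjacent
compatible Lie algebra. -/
theorem rep_of_subadjacent_compatible_Lie
    (π₁ π₂ : g →ₗ[K] g →ₗ[K] g) (ρ μ ρt μt : g →ₗ[K] Module.End K V)
    (h₁ : IsPreLie π₁) (h₂ : IsPreLie π₂) (h₃ : IsCompatPair π₁ π₂)
    (hrep : IsCompatRep π₁ π₂ ρ μ ρt μt) :
    (∀ x y : g, (ρ - μ) (π₁ x y - π₁ y x)
        = (ρ - μ) x * (ρ - μ) y - (ρ - μ) y * (ρ - μ) x) ∧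
    (∀ x y : g, (ρt - μt) (π₂ x y - π₂ y x)
        = (ρt - μt) x * (ρt - μt) y - (ρt - μt) y * (ρt - μt) x) ∧
    (∀ x y : g,
      (ρ - μ) (π₂ x y - π₂ y x) + (ρt - μt) (π₁ x y - π₁ y x)
        = ((ρ - μ) x * (ρt - μt) y - (ρt - μt) y * (ρ - μ) x)
          - ((ρ - μ) y * (ρt - μt) x - (ρt - μt) x * (ρ - μ) y)) := by
  obtain ⟨hr₁, hr₂, hρ, hμ⟩ := hrep
  refine ⟨hr₁.sub_map_commutator, hr₂.sub_map_commutator, fun x y => ?_⟩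
  have hρxy := hρ x y
  have hμxy := hμ x y
  have hμyx := hμ y x
  simp only [LinearMap.sub_apply, map_sub, sub_mul, mul_sub]
  linear_combination (norm := noncomm_ring) hρxy - hμxy + hμyx
end

section
/- Let (g,π₁,π₂) be a compatible pre-Lie algebra over a field K and let π₁′, π₂′ : g × g → g be bilinear maps. Then (g, π₁+π₁′, π₂+π₂′) is a compatible pre-Lie algebra if and only if for all x,y,z ∈ g: (i) [π₁,π₁′](x,y,z) + π₁′(π₁′(x,y),z) − π₁′(π₁′(y,x),z) − π₁′(x,π₁′(y,z)) + π₁′(y,π₁′(x,z)) = 0; (ii) [π₂,π₂′](x,y,z) + π₂′(π₂′(x,y),z) − π₂′(π₂′(y,x),z) − π₂′(x,π₂′(y,z)) + π₂′(y,π₂′(x,z)) = 0; (iii) [π₁,π₂′](x,y,z) + [π₂,π₁′](x,y,z) + [π₁′,π₂′](x,y,z) = 0. Here [P,Q] denotes the Matsushima–Nijenhuis bracket [P,Q](x,y,z) = P(Q(x,y),z) − P(Q(y,x),z) − P(x,Q(y,z)) + P(y,Q(x,z)) + Q(P(x,y),z) − Q(P(y,x),z) − Q(x,P(y,z)) + Q(y,P(x,z)).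 -/
variable {K : Type*} [Field K]
variable {g : Type*} [AddCommGroup g] [Module K g]
variable {V : Type*} [AddCommGroup V] [Module K V]

/-- The Matsushima–Nijenhuis bracket of two bilinear maps, as a trilinear expression. -/
def mnBracket (P Q : g →ₗ[K] g →ₗ[K] g) (x y z : g) : g :=
  P (Q x y) z - P (Q y x) z - P x (Q y z) + P y (Q x z)
    + Q (P x y) z - Q (P y x) z - Q x (P y z) + Q y (P x z)

theorem isCompatPair_iff_mnBracket_eq_zero (P Q : g →ₗ[K] g →ₗ[K] g) :
    IsCompatPair P Q ↔ ∀ x y z : g, mnBracket P Q x y z = 0 := by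
  refine forall₃_congr fun x y z => Eq.congr_left ?_
  simp only [mnBracket]
  abel

theorem mnBracket_comm (P Q : g →ₗ[K] g →ₗ[K] g) (x y z : g) :
    mnBracket P Q x y z = mnBracket Q P x y z := by
  simp only [mnBracket]
  abel

theorem mnBracket_add_right (P Q R : g →ₗ[K] g →ₗ[K] g) (x y z : g) :
    mnBracket P (Q + R) x y z = mnBracket P Q x y z + mnBracket P R x y z := by
  simp only [mnBracket, LinearMap.add_apply, map_add]
  abel

theorem mnBracket_add_left (P Q R : g →ₗ[K] g →ₗ[K] g) (x y z : g) :
    mnBracket (P + Q) R x y z = mnBracket P R x y z + mnBracket Q R x y z := by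
  simp only [mnBracket_comm _ R, mnBracket_add_right]

theorem IsPreLie.add_iff {P : g →ₗ[K] g →ₗ[K] g} (hP : IsPreLie P)
    (Q : g →ₗ[K] g →ₗ[K] g) :
    IsPreLie (P + Q) ↔ ∀ x y z : g,
      mnBracket P Q x y z
        + (Q (Q x y) z - Q (Q y x) z - Q x (Q y z) + Q y (Q x z)) = 0 := by
  refine forall₃_congr fun x y z => ?_
  rw [← sub_eq_zero]
  refine Eq.congr_left ?_
  rw [← sub_eq_zero, ← sub_eq_zero.mpr (hP x y z)]
  simp only [mnBracket, LinearMap.add_apply, map_add]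
  abel

theorem IsCompatPair.add_iff {P Q : g →ₗ[K] g →ₗ[K] g} (h : IsCompatPair P Q)
    (P' Q' : g →ₗ[K] g →ₗ[K] g) :
    IsCompatPair (P + P') (Q + Q') ↔ ∀ x y z : g,
      mnBracket P Q' x y z + mnBracket Q P' x y z + mnBracket P' Q' x y z = 0 := by
  rw [isCompatPair_iff_mnBracket_eq_zero] at h ⊢
  refine forall₃_congr fun x y z => Eq.congr_left ?_
  simp only [mnBracket_add_left, mnBracket_add_right, h x y z, mnBracket_comm Q P']
  abel

/-- (g,π₁+π₁',π₂+π₂') is a compatible pre-Lie algebra iff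
(π₁',π₂') satisfies the Maurer–Cartan equations of the bidifferential graded
Lie algebra controlling deformations. -/
theorem deformed_compatible_iff_MaurerCartan
    (π₁ π₂ π₁' π₂' : g →ₗ[K] g →ₗ[K] g)
    (h₁ : IsPreLie π₁) (h₂ : IsPreLie π₂) (h₃ : IsCompatPair π₁ π₂) :
    (IsPreLie (π₁ + π₁') ∧ IsPreLie (π₂ + π₂') ∧
      IsCompatPair (π₁ + π₁') (π₂ + π₂')) ↔
    ((∀ x y z : g,
        mnBracket π₁ π₁' x y z
          + (π₁' (π₁' x y) z - π₁' (π₁' y x) z - π₁' x (π₁' y z)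
              + π₁' y (π₁' x z)) = 0) ∧
     (∀ x y z : g,
        mnBracket π₂ π₂' x y z
          + (π₂' (π₂' x y) z - π₂' (π₂' y x) z - π₂' x (π₂' y z)
              + π₂' y (π₂' x z)) = 0) ∧
     (∀ x y z : g,
        mnBracket π₁ π₂' x y z + mnBracket π₂ π₁' x y z
          + mnBracket π₁' π₂' x y z = 0)) := by
  exact and_congr (h₁.add_iff π₁') (and_congr (h₂.add_iff π₂') (h₃.add_iff π₁' π₂'))
end

section
/- Let (g,·,∗) be a compatible pre-Lie algebra over a field K and let f : g → g be a linear map. Define bilinear maps θ(x,y) = x·f(y) + f(x)·y − f(x·y) and θ̃(x,y) = x∗f(y) + f(x)∗y − f(x∗y). Then (θ,θ̃) is a 2-cocycle of (g,·,∗) with coefficients in the regular representation; that is, for all x,y,z ∈ g: (i) θ(x·y,z) + θ(x,y)·z − θ(x,y·z) − x·θ(y,z) − θ(y·x,z) − θ(y,x)·z + θ(y,x·z) + y·θ(x,z) = 0; (ii) θ̃(x∗y,z) + θ̃(x,y)∗z − θ̃(x,y∗z) − x∗θ̃(y,z) − θ̃(y∗x,z) − θ̃(y,x)∗z + θ̃(y,x∗z)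 + y∗θ̃(x,z) = 0; (iii) θ(x∗y,z) + θ̃(x,y)·z + θ̃(x·y,z) + θ(x,y)∗z − θ(x,y∗z) − x·θ̃(y,z) − θ̃(x,y·z) − x∗θ(y,z) − θ(y∗x,z) − θ̃(y,x)·z − θ̃(y·x,z) − θ(y,x)∗z + θ(y,x∗z) + y·θ̃(x,z) + θ̃(y,x·z) + y∗θ(x,z) = 0. -/
variable {K : Type*} [Field K]
variable {g : Type*} [AddCommGroup g] [Module K g]
variable {V : Type*} [AddCommGroup V] [Module K V]

/-- The 2-cocycle condition for a single pre-Lie product (regular representation). -/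
def Cocycle1 (π : g →ₗ[K] g →ₗ[K] g) (θ : g → g → g) : Prop :=
  ∀ x y z : g,
    θ (π x y) z + π (θ x y) z - θ x (π y z) - π x (θ y z)
      - θ (π y x) z - π (θ y x) z + θ y (π x z) + π y (θ x z) = 0

/-- The mixed 2-cocycle condition (regular representation). -/
def CocycleMixed (π₁ π₂ : g →ₗ[K] g →ₗ[K] g) (θ θt : g → g → g) : Prop :=
  ∀ x y z : g,
    θ (π₂ x y) z + π₁ (θt x y) z + θt (π₁ x y) z + π₂ (θ x y) z
      - θ x (π₂ y z) - π₁ x (θt y z) - θt x (π₁ y z) - π₂ x (θ y z)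
      - θ (π₂ y x) z - π₁ (θt y x) z - θt (π₁ y x) z - π₂ (θ y x) z
      + θ y (π₂ x z) + π₁ y (θt x z) + θt y (π₁ x z) + π₂ y (θ x z) = 0

/-- The coboundary of a linear map f with respect to a product π. -/
def cobd (π : g →ₗ[K] g →ₗ[K] g) (f : g →ₗ[K] g) (x y : g) : g :=
  π (f x) y + π x (f y) - f (π x y)

/-- The coboundary of a linear map with respect to a pre-Lie product is a 2-cocycle. -/
theorem cocycle1_cobd (π : g →ₗ[K] g →ₗ[K] g) (f : g →ₗ[K] g) (h : IsPreLie π) :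
    Cocycle1 π (cobd π f) := by
  intro x y z
  have hf := congrArg f (h x y z)
  simp only [map_sub] at hf
  simp only [cobd, map_add, map_sub, LinearMap.add_apply, LinearMap.sub_apply]
  linear_combination (norm := abel) h (f x) y z + h x (f y) z + h x y (f z) - hf

/-- the coboundary of a linear map f : g → g is a 2-cocycle of
the compatible pre-Lie algebra with coefficients in the regular representation. -/
theorem coboundary_is_cocycle_regular
    (π₁ π₂ : g →ₗ[K] g →ₗ[K] g) (f : g →ₗ[K] g)
    (h₁ : IsPreLie π₁) (h₂ : IsPreLie π₂) (h₃ : IsCompatPair π₁ π₂) :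
    Cocycle1 π₁ (cobd π₁ f) ∧ Cocycle1 π₂ (cobd π₂ f) ∧
    CocycleMixed π₁ π₂ (cobd π₁ f) (cobd π₂ f) := by
  refine ⟨cocycle1_cobd π₁ f h₁, cocycle1_cobd π₂ f h₂, fun x y z => ?_⟩
  have hf := congrArg f (h₃ x y z)
  simp only [map_add, map_sub, map_zero] at hf
  simp only [cobd, map_add, map_sub, LinearMap.add_apply, LinearMap.sub_apply]
  linear_combination (norm := abel) h₃ (f x) y z + h₃ x (f y) z + h₃ x y (f z) - hf
end

section
/- Let (g,·,∗) be a compatible pre-Lie algebra over a field K of characteristic zero and let ω₁, ω₂ : g × g → g be bilinear maps such that for every t ∈ K the products x ·ₜ y = x·y + t ω₁(x,y) and x ∗ₜ y = x∗y + t ω₂(x,y) make (g,·ₜ,∗ₜ) a compatible pre-Lie algebra. Then (ω₁,ω₂) is a 2-cocycle of (g,·,∗) with coefficients in the regular representation, i.e. for all x,y,z ∈ g: (i) ω₁(x·y,z) + ω₁(x,y)·z − ω₁(x,y·z) − x·ω₁(y,z) − ω₁(y·x,z) − ω₁(y,x)·z + ω₁(y,x·z) + y·ω₁(x,z) = 0;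 (ii) ω₂(x∗y,z) + ω₂(x,y)∗z − ω₂(x,y∗z) − x∗ω₂(y,z) − ω₂(y∗x,z) − ω₂(y,x)∗z + ω₂(y,x∗z) + y∗ω₂(x,z) = 0; (iii) ω₁(x∗y,z) + ω₂(x,y)·z + ω₂(x·y,z) + ω₁(x,y)∗z − ω₁(x,y∗z) − x·ω₂(y,z) − ω₂(x,y·z) − x∗ω₁(y,z) − ω₁(y∗x,z) − ω₂(y,x)·z − ω₂(y·x,z) − ω₁(y,x)∗z + ω₁(y,x∗z) + y·ω₂(x,z) + ω₂(y,x·z) + y∗ω₁(x,z) = 0. Moreover (g,ω₁,ω₂) is itself a compatible pre-Lie algebra. -/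
variable {K : Type*} [Field K]
variable {g : Type*} [AddCommGroup g] [Module K g]
variable {V : Type*} [AddCommGroup V] [Module K V]

/-- A quadratic polynomial with vector coefficients that vanishes at `0`, `1` and `-1` has
vanishing linear and quadratic coefficients. -/
theorem coeff_eq_zero_of_quadratic_eq_zero [CharZero K] {a b c : g}
    (h : ∀ t : K, a + t • b + (t * t) • c = 0) : b = 0 ∧ c = 0 := by
  have h0 : a = 0 := by simpa using h 0
  have h1 : b + c = 0 := by simpa [h0] using h 1
  have h2 : -b + c = 0 := by simpa [h0] using h (-1)
  have hbc : c = b := by rwa [neg_add_eq_zero, eq_comm] at h2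
  have hb : (2 : K) • b = 0 := by rw [two_smul]; simpa [hbc] using h1
  have hb0 : b = 0 := (smul_eq_zero.mp hb).resolve_left two_ne_zero
  exact ⟨hb0, hbc.trans hb0⟩

theorem isPreLie_deformation_coeff [CharZero K] {π ω : g →ₗ[K] g →ₗ[K] g}
    (h : ∀ t : K, IsPreLie (π + t • ω)) :
    Cocycle1 π (fun x y => ω x y) ∧ IsPreLie ω := by
  have key (x y z : g) := coeff_eq_zero_of_quadratic_eq_zero (K := K)
    (a := π (π x y) z - π x (π y z) - π (π y x) z + π y (π x z))
    (b := ω (π x y) z + π (ω x y) z - ω x (π y z) - π x (ω y z)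
      - ω (π y x) z - π (ω y x) z + ω y (π x z) + π y (ω x z))
    (c := ω (ω x y) z - ω x (ω y z) - ω (ω y x) z + ω y (ω x z)) (fun t => by
      have e := sub_eq_zero.mpr (h t x y z)
      simp only [LinearMap.add_apply, LinearMap.smul_apply, map_add, map_smul] at e
      rw [← e]
      module)
  refine ⟨fun x y z => (key x y z).1, fun x y z => ?_⟩
  rw [← sub_eq_zero, ← (key x y z).2]
  abel

theorem isCompatPair_deformation_coeff [CharZero K] {π₁ π₂ ω₁ ω₂ : g →ₗ[K] g →ₗ[K] g}
    (h : ∀ t : K, IsCompatPair (π₁ + t • ω₁) (π₂ + t • ω₂)) :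
    CocycleMixed π₁ π₂ (fun x y => ω₁ x y) (fun x y => ω₂ x y) ∧ IsCompatPair ω₁ ω₂ := by
  rw [CocycleMixed, IsCompatPair]
  simp only [← forall_and]
  intro x y z
  refine coeff_eq_zero_of_quadratic_eq_zero (K := K)
    (a := π₁ (π₂ x y) z + π₂ (π₁ x y) z - π₁ x (π₂ y z) - π₂ x (π₁ y z)
      - π₁ (π₂ y x) z - π₂ (π₁ y x) z + π₁ y (π₂ x z) + π₂ y (π₁ x z)) fun t => ?_
  have e := h t x y z
  simp only [LinearMap.add_apply, LinearMap.smul_apply, map_add, map_smul] at e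
  rw [← e]
  module

/-- if (ω₁,ω₂) generates an infinitesimal deformation of a
compatible pre-Lie algebra over a field of characteristic zero, then (ω₁,ω₂)
is a 2-cocycle (regular representation), and (g,ω₁,ω₂) is itself a
compatible pre-Lie algebra. -/
theorem infinitesimal_deformation_gives_cocycle
    [CharZero K] (π₁ π₂ ω₁ ω₂ : g →ₗ[K] g →ₗ[K] g)
    (h₁ : IsPreLie π₁) (h₂ : IsPreLie π₂) (h₃ : IsCompatPair π₁ π₂)
    (hdef : ∀ t : K,
      IsPreLie (π₁ + t • ω₁) ∧ IsPreLie (π₂ + t • ω₂) ∧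
        IsCompatPair (π₁ + t • ω₁) (π₂ + t • ω₂)) :
    (Cocycle1 π₁ (fun x y => ω₁ x y) ∧ Cocycle1 π₂ (fun x y => ω₂ x y) ∧
      CocycleMixed π₁ π₂ (fun x y => ω₁ x y) (fun x y => ω₂ x y)) ∧
    (IsPreLie ω₁ ∧ IsPreLie ω₂ ∧ IsCompatPair ω₁ ω₂) := by
  have hc := isCompatPair_deformation_coeff fun t => (hdef t).2.2
  have hp₁ := isPreLie_deformation_coeff fun t => (hdef t).1
  have hp₂ := isPreLie_deformation_coeff fun t => (hdef t).2.1
  exact ⟨⟨hp₁.1, hp₂.1, hc.1⟩, hp₁.2, hp₂.2, hc.2⟩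
end

section
/- Let (g,·,∗) be a compatible pre-Lie algebra over a field K of characteristic zero. Suppose (ω₁,ω₂) and (ω₁′,ω₂′) generate infinitesimal deformations (g,·ₜ,∗ₜ) and (g,·ₜ′,∗ₜ′) respectively, where x ·ₜ y = x·y + t ω₁(x,y), x ∗ₜ y = x∗y + t ω₂(x,y), and similarly for the primed products. Suppose these deformations are equivalent, i.e. there exists a linear map N : g → g such that for every t ∈ K the map Id + tN is a compatible pre-Lie algebra homomorphism from (g,·ₜ′,∗ₜ′) to (g,·ₜ,∗ₜ): (Id+tN)(x ·ₜ′ y) = (Id+tN)(x) ·ₜ (Id+tN)(y) and (Id+tN)(x ∗ₜ′ y) = (Id+tN)(x) ∗ₜ (Id+tN)(y) for all x,y ∈ g. Then for all x,y ∈ g: ω₁′(x,y) − ω₁(x,y) = N(x)·y + x·N(y) − N(x·y) and ω₂′(x,y) − ω₂(x,y) = N(x)∗y + x∗N(y) − N(x∗y); that is, (ω₁′,ω₂′) and (ω₁,ω₂) differ by the coboundary of N and so lie in the same second cohomology class. -/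
variable {K : Type*} [Field K]
variable {g : Type*} [AddCommGroup g] [Module K g]
variable {V : Type*} [AddCommGroup V] [Module K V]

/-- A vector-valued cubic polynomial function without constant term that vanishes identically
over a field of characteristic zero has zero linear coefficient. -/
lemma linear_coeff_eq_zero_of_cubic_eq_zero [CharZero K] {a b c : g}
    (h : ∀ t : K, t • a + t ^ 2 • b + t ^ 3 • c = 0) : a = 0 := by
  have h₆ : (6 : K) • a = 0 := by
    linear_combination (norm := module) (6 : K) • h 1 - (2 : K) • h (-1) - h 2
  exact (smul_eq_zero.mp h₆).resolve_left (by norm_num)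

/-- If `id + t • N` intertwines the deformed products `π + t • ω'` and `π + t • ω` for all `t`,
then `ω' - ω` is the coboundary of `N`. -/
lemma sub_eq_coboundary_of_intertwining [CharZero K] (π ω ω' : g →ₗ[K] g →ₗ[K] g) (N : g →ₗ[K] g)
    (h : ∀ (t : K) (x y : g),
      π x y + t • ω' x y + t • N (π x y + t • ω' x y)
        = π (x + t • N x) (y + t • N y) + t • ω (x + t • N x) (y + t • N y)) (x y : g) :
    ω' x y - ω x y = π (N x) y + π x (N y) - N (π x y) := by
  rw [← sub_eq_zero]
  refine linear_coeff_eq_zero_of_cubic_eq_zero (K := K)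
    (b := N (ω' x y) - π (N x) (N y) - ω (N x) y - ω x (N y)) (c := -ω (N x) (N y)) fun t => ?_
  have ht := h t x y
  simp only [map_add, map_smul, LinearMap.add_apply, LinearMap.smul_apply] at ht
  rw [← sub_eq_zero] at ht
  rw [← ht]
  module

/-- equivalent infinitesimal deformations differ by the coboundary
of the linear map N. -/
theorem equivalent_deformations_differ_by_coboundary
    [CharZero K] (π₁ π₂ ω₁ ω₂ ω₁' ω₂' : g →ₗ[K] g →ₗ[K] g) (N : g →ₗ[K] g)
    (h₁ : IsPreLie π₁) (h₂ : IsPreLie π₂) (h₃ : IsCompatPair π₁ π₂)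
    (hdef : ∀ t : K,
      IsPreLie (π₁ + t • ω₁) ∧ IsPreLie (π₂ + t • ω₂) ∧
        IsCompatPair (π₁ + t • ω₁) (π₂ + t • ω₂))
    (hdef' : ∀ t : K,
      IsPreLie (π₁ + t • ω₁') ∧ IsPreLie (π₂ + t • ω₂') ∧
        IsCompatPair (π₁ + t • ω₁') (π₂ + t • ω₂'))
    (hequiv₁ : ∀ (t : K) (x y : g),
      π₁ x y + t • ω₁' x y + t • N (π₁ x y + t • ω₁' x y)
        = π₁ (x + t • N x) (y + t • N y) + t • ω₁ (x + t • N x) (y + t • N y))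
    (hequiv₂ : ∀ (t : K) (x y : g),
      π₂ x y + t • ω₂' x y + t • N (π₂ x y + t • ω₂' x y)
        = π₂ (x + t • N x) (y + t • N y) + t • ω₂ (x + t • N x) (y + t • N y)) :
    (∀ x y : g, ω₁' x y - ω₁ x y = π₁ (N x) y + π₁ x (N y) - N (π₁ x y)) ∧
    (∀ x y : g, ω₂' x y - ω₂ x y = π₂ (N x) y + π₂ x (N y) - N (π₂ x y)) := by
  exact ⟨sub_eq_coboundary_of_intertwining π₁ ω₁ ω₁' N hequiv₁,
    sub_eq_coboundary_of_intertwining π₂ ω₂ ω₂' N hequiv₂⟩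
end

section
/- Let N : g → g be a Nijenhuis operator on a compatible pre-Lie algebra (g,·,∗) over a field K. Define deformed products x ·_N y = N(x)·y + x·N(y) − N(x·y) and x ∗_N y = N(x)∗y + x∗N(y) − N(x∗y). Then (g, ·_N, ∗_N) is a compatible pre-Lie algebra and N is a compatible pre-Lie algebra homomorphism from (g,·_N,∗_N) to (g,·,∗), i.e. N(x ·_N y) = N(x)·N(y) and N(x ∗_N y) = N(x)∗N(y) for all x,y ∈ g. -/
variable {K : Type*} [Field K]
variable {g : Type*} [AddCommGroup g] [Module K g]
variable {V : Type*} [AddCommGroup V] [Module K V]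

/-- A Nijenhuis operator on a pre-Lie algebra (g,π). -/
def IsNijenhuis (π : g →ₗ[K] g →ₗ[K] g) (N : g →ₗ[K] g) : Prop :=
  ∀ x y : g, π (N x) (N y) = N (π (N x) y + π x (N y) - N (π x y))

/-- The product deformed by a linear map N :
x ·_N y = N(x)·y + x·N(y) − N(x·y). -/
def nijProd (π : g →ₗ[K] g →ₗ[K] g) (N : g →ₗ[K] g) : g →ₗ[K] g →ₗ[K] g :=
  LinearMap.mk₂ K (fun x y => π (N x) y + π x (N y) - N (π x y))
    (fun x x' y => by simp only [map_add, LinearMap.add_apply]; abel)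
    (fun c x y => by
      simp only [map_smul, LinearMap.smul_apply, smul_add, smul_sub])
    (fun x y y' => by simp only [map_add, LinearMap.add_apply]; abel)
    (fun c x y => by
      simp only [map_smul, LinearMap.smul_apply, smul_add, smul_sub])

theorem nijProd_apply (π : g →ₗ[K] g →ₗ[K] g) (N : g →ₗ[K] g) (x y : g) :
    nijProd π N x y = π (N x) y + π x (N y) - N (π x y) := rfl

theorem IsNijenhuis.map_nijProd {π : g →ₗ[K] g →ₗ[K] g} {N : g →ₗ[K] g}
    (hN : IsNijenhuis π N) (x y : g) : N (nijProd π N x y) = π (N x) (N y) :=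
  (hN x y).symm

theorem nijProd_add (π₁ π₂ : g →ₗ[K] g →ₗ[K] g) (N : g →ₗ[K] g) :
    nijProd (π₁ + π₂) N = nijProd π₁ N + nijProd π₂ N := by
  ext x y
  simp only [nijProd_apply, LinearMap.add_apply, map_add]
  abel

theorem IsNijenhuis.add {π₁ π₂ : g →ₗ[K] g →ₗ[K] g} {N : g →ₗ[K] g}
    (h₁ : IsNijenhuis π₁ N) (h₂ : IsNijenhuis π₂ N) : IsNijenhuis (π₁ + π₂) N := by
  intro x y
  have e₁ := h₁ x y
  have e₂ := h₂ x y
  simp only [LinearMap.add_apply, map_add, map_sub] at *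
  rw [e₁, e₂]
  abel

/-- Given two pre-Lie products, compatibility amounts to their sum being pre-Lie. -/
theorem IsPreLie.add_iff_s11 {π₁ π₂ : g →ₗ[K] g →ₗ[K] g}
    (h₁ : IsPreLie π₁) (h₂ : IsPreLie π₂) :
    IsPreLie (π₁ + π₂) ↔ IsCompatPair π₁ π₂ := by
  refine forall_congr' fun x => forall_congr' fun y => forall_congr' fun z => ?_
  have e₁ := h₁ x y z
  have e₂ := h₂ x y z
  simp only [LinearMap.add_apply, map_add]
  constructor <;> intro h
  · linear_combination (norm := abel) h - e₁ - e₂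
  · linear_combination (norm := abel) h + e₁ + e₂

/-- The associator of the deformed product in terms of associators of the original one. -/
theorem IsNijenhuis.associator_nijProd {π : g →ₗ[K] g →ₗ[K] g} {N : g →ₗ[K] g}
    (hN : IsNijenhuis π N) (x y z : g) :
    nijProd π N (nijProd π N x y) z - nijProd π N x (nijProd π N y z) =
      (π (π (N x) (N y)) z - π (N x) (π (N y) z))
      + (π (π (N x) y) (N z) - π (N x) (π y (N z)))
      + (π (π x (N y)) (N z) - π x (π (N y) (N z)))
      - N ((π (π x y) (N z) - π x (π y (N z)))
        + (π (π (N x) y) z - π (N x) (π y z))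
        + (π (π x (N y)) z - π x (π (N y) z)))
      + N (N (π (π x y) z - π x (π y z))) := by
  have e₁ := hN (π x y) z
  have e₂ := hN x (π y z)
  rw [nijProd_apply π N _ z, nijProd_apply π N x (nijProd π N y z),
    hN.map_nijProd, hN.map_nijProd]
  simp only [nijProd_apply, map_add, map_sub, LinearMap.add_apply, LinearMap.sub_apply] at *
  rw [e₁, e₂]
  abel

theorem IsPreLie.nijProd {π : g →ₗ[K] g →ₗ[K] g} {N : g →ₗ[K] g}
    (h : IsPreLie π) (hN : IsNijenhuis π N) : IsPreLie (nijProd π N) := by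
  intro x y z
  rw [hN.associator_nijProd, hN.associator_nijProd, h (N x) (N y) z, h (N x) y (N z),
    h x (N y) (N z), h x y (N z), h (N x) y z, h x (N y) z, h x y z]
  simp only [map_add, map_sub]
  abel

/-- the deformed products of a Nijenhuis operator form a
compatible pre-Lie algebra, and N is a homomorphism from the deformed
structure to the original one. -/
theorem nijenhuis_deformed_compatible
    (π₁ π₂ : g →ₗ[K] g →ₗ[K] g) (N : g →ₗ[K] g)
    (h₁ : IsPreLie π₁) (h₂ : IsPreLie π₂) (h₃ : IsCompatPair π₁ π₂)
    (hN₁ : IsNijenhuis π₁ N) (hN₂ : IsNijenhuis π₂ N) :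
    IsPreLie (nijProd π₁ N) ∧ IsPreLie (nijProd π₂ N) ∧
    IsCompatPair (nijProd π₁ N) (nijProd π₂ N) ∧
    (∀ x y : g, N (nijProd π₁ N x y) = π₁ (N x) (N y)) ∧
    (∀ x y : g, N (nijProd π₂ N x y) = π₂ (N x) (N y)) := by
  have p₁ := h₁.nijProd hN₁
  have p₂ := h₂.nijProd hN₂
  refine ⟨p₁, p₂, (p₁.add_iff_s11 p₂).1 ?_, hN₁.map_nijProd, hN₂.map_nijProd⟩
  rw [← nijProd_add]
  exact ((h₁.add_iff_s11 h₂).2 h₃).nijProd (hN₁.add hN₂)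
end

section
/- Let N be a Nijenhuis operator on a compatible pre-Lie algebra (g,·,∗) over a field K. Define ω₁(x,y) = N(x)·y + x·N(y) − N(x·y) and ω₂(x,y) = N(x)∗y + x∗N(y) − N(x∗y). Then (ω₁,ω₂) generates a trivial infinitesimal deformation: for every t ∈ K, the products x ·ₜ y = x·y + t ω₁(x,y) and x ∗ₜ y = x∗y + t ω₂(x,y) make (g,·ₜ,∗ₜ) a compatible pre-Lie algebra, and Id + tN is a compatible pre-Lie algebra homomorphism from (g,·ₜ,∗ₜ) to (g,·,∗), i.e. (Id+tN)(x ·ₜ y) = (Id+tN)(x)·(Id+tN)(y) and (Id+tN)(x ∗ₜ y) = (Id+tN)(x)∗(Id+tN)(y) for all x,y ∈ g. -/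
variable {K : Type*} [Field K]
variable {g : Type*} [AddCommGroup g] [Module K g]
variable {V : Type*} [AddCommGroup V] [Module K V]

/-- The mixed associator of two products. -/
def mixedAssociator (π ρ : g →ₗ[K] g →ₗ[K] g) (x y z : g) : g :=
  π (ρ x y) z - π x (ρ y z)

/-- The effect on a ternary operation `F`, such as a mixed associator, of deforming the underlying
products by `t` times a Nijenhuis operator `N`. -/
def ternaryDeformation (N : g →ₗ[K] g) (t : K) (F : g → g → g → g) (x y z : g) : g :=
  F x y z + t • (F (N x) y z + F x (N y) z + F x y (N z) - N (F x y z)) +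
    (t * t) • (F (N x) (N y) z + F (N x) y (N z) + F x (N y) (N z) -
      N (F (N x) y z + F x (N y) z + F x y (N z) - N (F x y z)))

theorem ternaryDeformation_add (N : g →ₗ[K] g) (t : K) (F G : g → g → g → g) :
    ternaryDeformation N t (F + G) = ternaryDeformation N t F + ternaryDeformation N t G := by
  funext x y z
  simp only [ternaryDeformation, Pi.add_apply, map_add, map_sub]
  module

theorem ternaryDeformation_swap (N : g →ₗ[K] g) (t : K) {F : g → g → g → g}
    (hF : ∀ x y z, F x y z = F y x z) (x y z : g) :
    ternaryDeformation N t F x y z = ternaryDeformation N t F y x z := by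
  simp only [ternaryDeformation, hF y x, hF y (N x), hF (N y) x, hF (N y) (N x), map_add, map_sub]
  module

theorem isPreLie_iff_mixedAssociator {π : g →ₗ[K] g →ₗ[K] g} :
    IsPreLie π ↔ ∀ x y z, mixedAssociator π π x y z = mixedAssociator π π y x z :=
  Iff.rfl

theorem isCompatPair_iff_mixedAssociator {π ρ : g →ₗ[K] g →ₗ[K] g} :
    IsCompatPair π ρ ↔ ∀ x y z, (mixedAssociator π ρ + mixedAssociator ρ π) x y z =
      (mixedAssociator π ρ + mixedAssociator ρ π) y x z := by
  refine forall_congr' fun x => forall_congr' fun y => forall_congr' fun z => ?_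
  rw [← sub_eq_zero (b := (mixedAssociator π ρ + mixedAssociator ρ π) y x z)]
  simp only [mixedAssociator, Pi.add_apply]
  refine Eq.congr ?_ rfl
  abel

namespace IsNijenhuis

variable {π ρ : g →ₗ[K] g →ₗ[K] g} {N : g →ₗ[K] g}

theorem mixedAssociator_deformation (hπ : IsNijenhuis π N) (hρ : IsNijenhuis ρ N) (t : K) :
    mixedAssociator (π + t • nijProd π N) (ρ + t • nijProd ρ N) =
      ternaryDeformation N t (mixedAssociator π ρ) := by
  funext x y z
  have hxy : N (ρ (N x) y) + N (ρ x (N y)) - N (N (ρ x y)) = ρ (N x) (N y) := by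
    rw [hρ x y, map_sub, map_add]
  have hyz : N (ρ (N y) z) + N (ρ y (N z)) - N (N (ρ y z)) = ρ (N y) (N z) := by
    rw [hρ y z, map_sub, map_add]
  have hl := congrArg (fun u => π u z) hxy
  have hr := congrArg (π x) hyz
  have hl' := hπ (ρ x y) z
  have hr' := hπ x (ρ y z)
  simp only [map_add, map_sub, LinearMap.add_apply, LinearMap.sub_apply] at hl hr hl' hr'
  simp only [mixedAssociator, ternaryDeformation, nijProd_apply, map_add, map_sub, map_smul,
    LinearMap.add_apply, LinearMap.sub_apply, LinearMap.smul_apply]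
  linear_combination (norm := module)
    (t * t) • hl - (t * t) • hr - (t * t) • hl' + (t * t) • hr'

theorem isPreLie_deformation (hN : IsNijenhuis π N) (h : IsPreLie π) (t : K) :
    IsPreLie (π + t • nijProd π N) := by
  rw [isPreLie_iff_mixedAssociator, hN.mixedAssociator_deformation hN]
  exact ternaryDeformation_swap N t (isPreLie_iff_mixedAssociator.1 h)

theorem isCompatPair_deformation (hπ : IsNijenhuis π N) (hρ : IsNijenhuis ρ N)
    (h : IsCompatPair π ρ) (t : K) :
    IsCompatPair (π + t • nijProd π N) (ρ + t • nijProd ρ N) := by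
  rw [isCompatPair_iff_mixedAssociator, hπ.mixedAssociator_deformation hρ,
    hρ.mixedAssociator_deformation hπ, ← ternaryDeformation_add]
  exact ternaryDeformation_swap N t (isCompatPair_iff_mixedAssociator.1 h)

theorem id_add_smul_map_deformation (hN : IsNijenhuis π N) (t : K) (x y : g) :
    π x y + t • nijProd π N x y + t • N (π x y + t • nijProd π N x y) =
      π (x + t • N x) (y + t • N y) := by
  have h : N (nijProd π N x y) = π (N x) (N y) := (hN x y).symm
  simp only [map_add, map_smul, LinearMap.add_apply, LinearMap.smul_apply, h]
  rw [nijProd_apply]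
  module

end IsNijenhuis

/-- a Nijenhuis operator generates a trivial infinitesimal
deformation of the compatible pre-Lie algebra. -/
theorem nijenhuis_generates_trivial_deformation
    (π₁ π₂ : g →ₗ[K] g →ₗ[K] g) (N : g →ₗ[K] g)
    (h₁ : IsPreLie π₁) (h₂ : IsPreLie π₂) (h₃ : IsCompatPair π₁ π₂)
    (hN₁ : IsNijenhuis π₁ N) (hN₂ : IsNijenhuis π₂ N) :
    ∀ t : K,
      IsPreLie (π₁ + t • nijProd π₁ N) ∧
      IsPreLie (π₂ + t • nijProd π₂ N) ∧
      IsCompatPair (π₁ + t • nijProd π₁ N) (π₂ + t • nijProd π₂ N) ∧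
      (∀ x y : g,
        π₁ x y + t • nijProd π₁ N x y
            + t • N (π₁ x y + t • nijProd π₁ N x y)
          = π₁ (x + t • N x) (y + t • N y)) ∧
      (∀ x y : g,
        π₂ x y + t • nijProd π₂ N x y
            + t • N (π₂ x y + t • nijProd π₂ N x y)
          = π₂ (x + t • N x) (y + t • N y)) := by
  exact fun t => ⟨hN₁.isPreLie_deformation h₁ t, hN₂.isPreLie_deformation h₂ t,
    hN₁.isCompatPair_deformation hN₂ h₃ t, hN₁.id_add_smul_map_deformation t,
    hN₂.id_add_smul_map_deformation t⟩
end

section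
/- Let (g,π₁,π₂) be a compatible pre-Lie algebra over a field K and let (π₁ⁱ, π₂ⁱ)_{i≥1} be a 1-parameter formal deformation of (g,π₁,π₂) (with π₁⁰ = π₁, π₂⁰ = π₂). Suppose n ≥ 1 and π₁ⁱ = π₂ⁱ = 0 for all 1 ≤ i ≤ n−1. Then (π₁ⁿ, π₂ⁿ) is a 2-cocycle of (g,π₁,π₂) with coefficients in the regular representation: writing x·y = π₁(x,y), x∗y = π₂(x,y), ω₁ = π₁ⁿ, ω₂ = π₂ⁿ, for all x,y,z ∈ g: (i) ω₁(x·y,z) + ω₁(x,y)·z − ω₁(x,y·z) − x·ω₁(y,z) − ω₁(y·x,z) − ω₁(y,x)·z + ω₁(y,x·z) + y·ω₁(x,z) = 0; (ii) ω₂(x∗y,z) + ω₂(x,y)∗z − ω₂(x,y∗z) − x∗ω₂(y,z) − ω₂(y∗x,z) − ω₂(y,x)∗z + ω₂(y,x∗z) + y∗ω₂(x,z) = 0; (iii) ω₁(x∗y,z) + ω₂(x,y)·z + ω₂(x·y,z) + ω₁(x,y)∗z − ω₁(x,y∗z) − x·ω₂(y,z) − ω₂(x,y·z) − x∗ω₁(y,z)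 − ω₁(y∗x,z) − ω₂(y,x)·z − ω₂(y·x,z) − ω₁(y,x)∗z + ω₁(y,x∗z) + y·ω₂(x,z) + ω₂(y,x·z) + y∗ω₁(x,z) = 0. -/
variable {K : Type*} [Field K]
variable {g : Type*} [AddCommGroup g] [Module K g]
variable {V : Type*} [AddCommGroup V] [Module K V]

/-- A 1-parameter formal deformation of a compatible pre-Lie algebra, given as
the sequences of its coefficients (with index 0 the original products). -/
def IsFormalDeformation (P₁ P₂ : ℕ → (g →ₗ[K] g →ₗ[K] g)) : Prop :=
  ∀ n : ℕ, 1 ≤ n → ∀ x y z : g,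
    (∑ i ∈ Finset.range (n + 1),
      (P₁ i (P₁ (n - i) x y) z - P₁ i x (P₁ (n - i) y z)
        - P₁ i (P₁ (n - i) y x) z + P₁ i y (P₁ (n - i) x z)) = 0) ∧
    (∑ i ∈ Finset.range (n + 1),
      (P₂ i (P₂ (n - i) x y) z - P₂ i x (P₂ (n - i) y z)
        - P₂ i (P₂ (n - i) y x) z + P₂ i y (P₂ (n - i) x z)) = 0) ∧
    (∑ i ∈ Finset.range (n + 1),
      (P₁ i (P₂ (n - i) x y) z + P₂ (n - i) (P₁ i x y) z
        - P₁ i x (P₂ (n - i) y z) - P₂ (n - i) x (P₁ i y z)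
        - P₁ i (P₂ (n - i) y x) z - P₂ (n - i) (P₁ i y x) z
        + P₁ i y (P₂ (n - i) x z) + P₂ (n - i) y (P₁ i x z)) = 0)

/-- A sum over `0, ..., n` whose terms vanish strictly between the endpoints is the sum of the
two extreme terms. -/
lemma sum_range_succ_eq_ends {M : Type*} [AddCommMonoid M] {n : ℕ} (hn : 1 ≤ n) (f : ℕ → M)
    (hf : ∀ i, 1 ≤ i → i < n → f i = 0) :
    ∑ i ∈ Finset.range (n + 1), f i = f 0 + f n := by
  rw [Finset.sum_range_succ, Finset.sum_eq_single_of_mem 0 (Finset.mem_range.mpr hn)]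
  intro i hi hi0
  exact hf i (Nat.one_le_iff_ne_zero.mpr hi0) (Finset.mem_range.mp hi)

/-- in a 1-parameter formal deformation whose coefficients vanish
in degrees 1,...,n-1, the pair of n-th coefficients is a 2-cocycle with
coefficients in the regular representation. -/
theorem first_nonvanishing_term_is_cocycle
    (P₁ P₂ : ℕ → (g →ₗ[K] g →ₗ[K] g))
    (h₁ : IsPreLie (P₁ 0)) (h₂ : IsPreLie (P₂ 0))
    (h₃ : IsCompatPair (P₁ 0) (P₂ 0))
    (hdef : IsFormalDeformation P₁ P₂)
    (n : ℕ) (hn : 1 ≤ n)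
    (hvanish : ∀ i : ℕ, 1 ≤ i → i < n → P₁ i = 0 ∧ P₂ i = 0) :
    Cocycle1 (P₁ 0) (fun x y => P₁ n x y) ∧
    Cocycle1 (P₂ 0) (fun x y => P₂ n x y) ∧
    CocycleMixed (P₁ 0) (P₂ 0) (fun x y => P₁ n x y) (fun x y => P₂ n x y) := by
  have hz₁ : ∀ i, 1 ≤ i → i < n → P₁ i = 0 := fun i hi hin => (hvanish i hi hin).1
  have hz₂ : ∀ i, 1 ≤ i → i < n → P₂ i = 0 := fun i hi hin => (hvanish i hi hin).2
  refine ⟨fun x y z => ?_, fun x y z => ?_, fun x y z => ?_⟩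
  · have h := (hdef n hn x y z).1
    rw [sum_range_succ_eq_ends hn _ fun i hi hin => by
      simp [hz₁ i hi hin]] at h
    simp only [Nat.sub_zero, Nat.sub_self] at h
    rw [← h]
    abel
  · have h := (hdef n hn x y z).2.1
    rw [sum_range_succ_eq_ends hn _ fun i hi hin => by
      simp [hz₂ i hi hin]] at h
    simp only [Nat.sub_zero, Nat.sub_self] at h
    rw [← h]
    abel
  · have h := (hdef n hn x y z).2.2
    rw [sum_range_succ_eq_ends hn _ fun i hi hin => by
      simp [hz₁ i hi hin, hz₂ (n - i) (by omega) (by omega)]] at h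
    simp only [Nat.sub_zero, Nat.sub_self] at h
    rw [← h]
    abel
end

section
/- Let (g,π₁,π₂) be a compatible pre-Lie algebra over a field K, written x·y = π₁(x,y), x∗y = π₂(x,y). Assume the second cohomology with coefficients in the regular representation vanishes in the following sense: every pair of bilinear maps (ω₁,ω₂) satisfying the three 2-cocycle equations (i) ω₁(x·y,z) + ω₁(x,y)·z − ω₁(x,y·z) − x·ω₁(y,z) − ω₁(y·x,z) − ω₁(y,x)·z + ω₁(y,x·z) + y·ω₁(x,z) = 0, (ii) the analogous equation for ω₂ with ∗, and (iii) the mixed equation ω₁(x∗y,z) + ω₂(x,y)·z + ω₂(x·y,z) + ω₁(x,y)∗z − ω₁(x,y∗z) − x·ω₂(y,z) − ω₂(x,y·z) − x∗ω₁(y,z) − ω₁(y∗x,z) − ω₂(y,x)·z − ω₂(y·x,z) − ω₁(y,x)∗z + ω₁(y,x∗z) + y·ω₂(x,z) + ω₂(y,x·z) + y∗ω₁(x,z) = 0, is a coboundary, i.e. there exists a linear map φ : g → g with ω₁(x,y) = φ(x)·y + x·φ(y) − φ(x·y) and ω₂(x,y) = φ(x)∗y + x∗φ(y) − φ(x∗y)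 for all x,y. Then (g,π₁,π₂) is rigid: every 1-parameter formal deformation (π₁ⁱ,π₂ⁱ)_{i≥1} of (g,π₁,π₂) is trivial, i.e. there exists a sequence of linear maps φᵢ : g → g (i ≥ 0) with φ₀ = Id such that for every n ≥ 0 and all x,y ∈ g: Σ_{i+j=n} φᵢ(π₁ʲ(x,y)) = Σ_{i+j=n} π₁(φᵢ(x), φⱼ(y)) and Σ_{i+j=n} φᵢ(π₂ʲ(x,y)) = Σ_{i+j=n} π₂(φᵢ(x), φⱼ(y)). -/
variable {K : Type*} [Field K]
variable {g : Type*} [AddCommGroup g] [Module K g]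
variable {V : Type*} [AddCommGroup V] [Module K V]

open Finset.HasAntidiagonal (antidiagonal)

section Series

variable {R U W M N : Type*} [CommRing R] [AddCommGroup U] [Module R U]
  [AddCommGroup W] [Module R W] [AddCommGroup M] [Module R M]

/-- The Cauchy product of two formal power series (given by their coefficients) along a bilinear
map. -/
def cauchyProd (f : U →ₗ[R] W →ₗ[R] M) : (ℕ → U) →ₗ[R] (ℕ → W) →ₗ[R] (ℕ → M) :=
  LinearMap.mk₂ R (fun a b n => ∑ p ∈ antidiagonal n, f (a p.1) (b p.2))
    (fun a b c => by ext n; simp [Finset.sum_add_distrib])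
    (fun r a b => by ext n; simp [Finset.smul_sum])
    (fun a b c => by ext n; simp [Finset.sum_add_distrib])
    (fun r a b => by ext n; simp [Finset.smul_sum])

theorem cauchyProd_apply (f : U →ₗ[R] W →ₗ[R] M) (a : ℕ → U) (b : ℕ → W) (n : ℕ) :
    cauchyProd f a b n = ∑ p ∈ antidiagonal n, f (a p.1) (b p.2) := rfl

/-- The constant power series with a given constant term. -/
def constSeries (R : Type*) {U : Type*} [CommRing R] [AddCommGroup U] [Module R U] :
    U →ₗ[R] (ℕ → U) :=
  LinearMap.single R (fun _ => U) 0

@[simp] theorem constSeries_zero (u : U) : constSeries R u 0 = u := by simp [constSeries]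

@[simp] theorem constSeries_succ (u : U) (n : ℕ) : constSeries R u (n + 1) = 0 := by
  simp [constSeries]

/-- Multiplication of a power series by the formal variable. -/
def shiftSeries (a : ℕ → U) : ℕ → U
  | 0 => 0
  | n + 1 => a n

@[simp] theorem shiftSeries_zero (a : ℕ → U) : shiftSeries a 0 = 0 := rfl

@[simp] theorem shiftSeries_succ (a : ℕ → U) (n : ℕ) : shiftSeries a (n + 1) = a n := rfl

theorem shiftSeries_add (a b : ℕ → U) :
    shiftSeries (a + b) = shiftSeries a + shiftSeries b := by
  ext (_ | n) <;> simp

theorem shiftSeries_sub (a b : ℕ → U) :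
    shiftSeries (a - b) = shiftSeries a - shiftSeries b := by
  ext (_ | n) <;> simp

theorem eq_constSeries_add_shiftSeries (a : ℕ → U) :
    a = constSeries R (a 0) + shiftSeries (fun n => a (n + 1)) := by
  ext (_ | n) <;> simp

@[simp] theorem cauchyProd_shiftSeries_left (f : U →ₗ[R] W →ₗ[R] M) (a : ℕ → U) (b : ℕ → W) :
    cauchyProd f (shiftSeries a) b = shiftSeries (cauchyProd f a b) := by
  ext (_ | n) <;> simp [cauchyProd_apply, Finset.Nat.sum_antidiagonal_succ]

@[simp] theorem cauchyProd_shiftSeries_right (f : U →ₗ[R] W →ₗ[R] M) (a : ℕ → U) (b : ℕ → W) :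
    cauchyProd f a (shiftSeries b) = shiftSeries (cauchyProd f a b) := by
  ext (_ | n) <;> simp [cauchyProd_apply, Finset.Nat.sum_antidiagonal_succ']

theorem cauchyProd_apply_of_left_vanish (f : U →ₗ[R] W →ₗ[R] M) {a : ℕ → U} (b : ℕ → W) {n : ℕ}
    (ha : ∀ k < n, a k = 0) : cauchyProd f a b n = f (a n) (b 0) := by
  rw [cauchyProd_apply, Finset.sum_eq_single (n, 0)]
  · rintro ⟨i, j⟩ hp hne
    rw [Finset.HasAntidiagonal.mem_antidiagonal] at hp
    have : i < n := by
      by_contra! h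
      exact hne (by ext <;> simp at hp ⊢ <;> omega)
    simp [ha i this]
  · simp

theorem cauchyProd_apply_of_right_vanish (f : U →ₗ[R] W →ₗ[R] M) (a : ℕ → U) {b : ℕ → W} {n : ℕ}
    (hb : ∀ k < n, b k = 0) : cauchyProd f a b n = f (a 0) (b n) := by
  rw [cauchyProd_apply, Finset.sum_eq_single (0, n)]
  · rintro ⟨i, j⟩ hp hne
    rw [Finset.HasAntidiagonal.mem_antidiagonal] at hp
    have : j < n := by
      by_contra! h
      exact hne (by ext <;> simp at hp ⊢ <;> omega)
    simp [hb j this]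
  · simp

@[simp] theorem cauchyProd_constSeries_left (f : U →ₗ[R] W →ₗ[R] M) (u : U) (b : ℕ → W) (n : ℕ) :
    cauchyProd f (constSeries R u) b n = f u (b n) := by
  rw [cauchyProd_apply, Finset.sum_eq_single (0, n)]
  · simp
  · rintro ⟨_ | i, j⟩ hp hne
    · exact absurd (by simpa using hp) (by simpa using hne)
    · simp
  · simp

@[simp] theorem cauchyProd_constSeries_right (f : U →ₗ[R] W →ₗ[R] M) (a : ℕ → U) (w : W) (n : ℕ) :
    cauchyProd f a (constSeries R w) n = f (a n) w := by
  rw [cauchyProd_apply, Finset.sum_eq_single (n, 0)]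
  · simp
  · rintro ⟨i, _ | j⟩ hp hne
    · exact absurd (by simpa using hp) (by simpa using hne)
    · simp
  · simp

theorem cauchyProd_constSeries (f : U →ₗ[R] W →ₗ[R] M) (u : U) (w : W) :
    cauchyProd f (constSeries R u) (constSeries R w) = constSeries R (f u w) := by
  ext (_ | n) <;> simp

/-- The action of a power series of linear maps on power series of vectors. -/
abbrev seriesMap (φ : ℕ → (U →ₗ[R] W)) : (ℕ → U) →ₗ[R] (ℕ → W) :=
  cauchyProd LinearMap.id φ

/-- The action of a power series of bilinear maps on pairs of power series of vectors. -/
def seriesMap₂ (P : ℕ → (U →ₗ[R] W →ₗ[R] M)) : (ℕ → U) →ₗ[R] (ℕ → W) →ₗ[R] (ℕ → M) :=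
  cauchyProd LinearMap.id ∘ₗ seriesMap P

theorem seriesMap₂_apply (P : ℕ → (U →ₗ[R] W →ₗ[R] M)) (a : ℕ → U) (b : ℕ → W) :
    seriesMap₂ P a b = seriesMap (seriesMap P a) b := rfl

/-- A map commuting with multiplication by the formal variable is determined up to order `n` by
the constant term of its argument, provided it vanishes below order `n` on constant series. -/
theorem apply_eq_apply_constSeries {X : Type*} [AddCommGroup X] (F : (ℕ → U) → (ℕ → X))
    (hadd : ∀ a b, F (a + b) = F a + F b) (hshift : ∀ a, F (shiftSeries a) = shiftSeries (F a))
    {n : ℕ} (hF : ∀ u, ∀ k < n, F (constSeries R u) k = 0) :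
    ∀ k ≤ n, ∀ a, F a k = F (constSeries R (a 0)) k := by
  intro k
  induction k with
  | zero =>
    intro _ a
    conv_lhs => rw [eq_constSeries_add_shiftSeries (R := R) a, hadd, hshift]
    simp
  | succ k ih =>
    intro hk a
    conv_lhs => rw [eq_constSeries_add_shiftSeries (R := R) a, hadd, hshift]
    simp [ih (by omega) (fun n => a (n + 1)), hF _ k (by omega)]

theorem eq_zero_of_constSeries {X : Type*} [AddCommGroup X] (F : (ℕ → U) → (ℕ → X))
    (hadd : ∀ a b, F (a + b) = F a + F b) (hshift : ∀ a, F (shiftSeries a) = shiftSeries (F a))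
    (hF : ∀ u, F (constSeries R u) = 0) (a : ℕ → U) : F a = 0 := by
  ext n
  rw [apply_eq_apply_constSeries (R := R) F hadd hshift (n := n)
    (fun u k _ => by simp [hF]) n le_rfl, hF]

/-- The associator-type expression of two products, antisymmetrized in the first two arguments. -/
def altAssoc (p q : M →ₗ[R] M →ₗ[R] M) (x y z : M) : M :=
  p (q x y) z - p x (q y z) - p (q y x) z + p y (q x z)

theorem altAssoc_cauchyProd_constSeries (p q : M →ₗ[R] M →ₗ[R] M) (x y z : M) :
    altAssoc (cauchyProd p) (cauchyProd q) (constSeries R x) (constSeries R y) (constSeries R z)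
      = constSeries R (altAssoc p q x y z) := by
  simp [altAssoc, cauchyProd_constSeries]

theorem altAssoc_add_left (p q : M →ₗ[R] M →ₗ[R] M) (x x' y z : M) :
    altAssoc p q (x + x') y z = altAssoc p q x y z + altAssoc p q x' y z := by
  simp only [altAssoc, map_add, LinearMap.add_apply]; abel

theorem altAssoc_add_middle (p q : M →ₗ[R] M →ₗ[R] M) (x y y' z : M) :
    altAssoc p q x (y + y') z = altAssoc p q x y z + altAssoc p q x y' z := by
  simp only [altAssoc, map_add, LinearMap.add_apply]; abel

theorem altAssoc_add_right (p q : M →ₗ[R] M →ₗ[R] M) (x y z z' : M) :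
    altAssoc p q x y (z + z') = altAssoc p q x y z + altAssoc p q x y z' := by
  simp only [altAssoc, map_add]; abel

theorem altAssoc_cauchyProd_shiftSeries_left (p q : M →ₗ[R] M →ₗ[R] M) (a b c : ℕ → M) :
    altAssoc (cauchyProd p) (cauchyProd q) (shiftSeries a) b c
      = shiftSeries (altAssoc (cauchyProd p) (cauchyProd q) a b c) := by
  simp [altAssoc, shiftSeries_add, shiftSeries_sub]

theorem altAssoc_cauchyProd_shiftSeries_middle (p q : M →ₗ[R] M →ₗ[R] M) (a b c : ℕ → M) :
    altAssoc (cauchyProd p) (cauchyProd q) a (shiftSeries b) c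
      = shiftSeries (altAssoc (cauchyProd p) (cauchyProd q) a b c) := by
  simp [altAssoc, shiftSeries_add, shiftSeries_sub]

theorem altAssoc_cauchyProd_shiftSeries_right (p q : M →ₗ[R] M →ₗ[R] M) (a b c : ℕ → M) :
    altAssoc (cauchyProd p) (cauchyProd q) a b (shiftSeries c)
      = shiftSeries (altAssoc (cauchyProd p) (cauchyProd q) a b c) := by
  simp [altAssoc, shiftSeries_add, shiftSeries_sub]

theorem altAssoc_cauchyProd_self (p : M →ₗ[R] M →ₗ[R] M)
    (h : ∀ x y z, altAssoc p p x y z = 0) (a b c : ℕ → M) :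
    altAssoc (cauchyProd p) (cauchyProd p) a b c = 0 := by
  refine eq_zero_of_constSeries (R := R)
    (fun a => altAssoc (cauchyProd p) (cauchyProd p) a b c) (fun _ _ => altAssoc_add_left ..)
    (fun _ => altAssoc_cauchyProd_shiftSeries_left ..) (fun x => ?_) a
  refine eq_zero_of_constSeries (R := R)
    (fun b => altAssoc (cauchyProd p) (cauchyProd p) _ b c) (fun _ _ => altAssoc_add_middle ..)
    (fun _ => altAssoc_cauchyProd_shiftSeries_middle ..) (fun y => ?_) b
  refine eq_zero_of_constSeries (R := R)
    (fun c => altAssoc (cauchyProd p) (cauchyProd p) _ _ c) (fun _ _ => altAssoc_add_right ..)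
    (fun _ => altAssoc_cauchyProd_shiftSeries_right ..) (fun z => ?_) c
  simp [altAssoc_cauchyProd_constSeries, h]

theorem altAssoc_cauchyProd_add_swap (p q : M →ₗ[R] M →ₗ[R] M)
    (h : ∀ x y z, altAssoc p q x y z + altAssoc q p x y z = 0) (a b c : ℕ → M) :
    altAssoc (cauchyProd p) (cauchyProd q) a b c
      + altAssoc (cauchyProd q) (cauchyProd p) a b c = 0 := by
  refine eq_zero_of_constSeries (R := R)
    (fun a => altAssoc (cauchyProd p) (cauchyProd q) a b c
      + altAssoc (cauchyProd q) (cauchyProd p) a b c)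
    (fun _ _ => by simp only [altAssoc_add_left]; abel)
    (fun _ => by simp only [altAssoc_cauchyProd_shiftSeries_left, shiftSeries_add])
    (fun x => ?_) a
  refine eq_zero_of_constSeries (R := R)
    (fun b => altAssoc (cauchyProd p) (cauchyProd q) _ b c
      + altAssoc (cauchyProd q) (cauchyProd p) _ b c)
    (fun _ _ => by simp only [altAssoc_add_middle]; abel)
    (fun _ => by simp only [altAssoc_cauchyProd_shiftSeries_middle, shiftSeries_add])
    (fun y => ?_) b
  refine eq_zero_of_constSeries (R := R)
    (fun c => altAssoc (cauchyProd p) (cauchyProd q) _ _ c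
      + altAssoc (cauchyProd q) (cauchyProd p) _ _ c)
    (fun _ _ => by simp only [altAssoc_add_right]; abel)
    (fun _ => by simp only [altAssoc_cauchyProd_shiftSeries_right, shiftSeries_add])
    (fun z => ?_) c
  simp only [altAssoc_cauchyProd_constSeries, ← map_add, h, map_zero]

theorem altAssoc_seriesMap₂_constSeries (P Q : ℕ → (M →ₗ[R] M →ₗ[R] M)) (x y z : M) (n : ℕ) :
    altAssoc (seriesMap₂ P) (seriesMap₂ Q) (constSeries R x) (constSeries R y) (constSeries R z) n
      = ∑ i ∈ antidiagonal n, altAssoc (P i.1) (Q i.2) x y z := by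
  simp [altAssoc, seriesMap₂_apply, cauchyProd_apply LinearMap.id _ (cauchyProd _ _ _),
    Finset.sum_add_distrib, Finset.sum_sub_distrib, LinearMap.sum_apply]

/-- The failure of a power series of linear maps to intertwine a power series of products with a
constant product. -/
def morphismDefect (φ : ℕ → (M →ₗ[R] M)) (P : ℕ → (M →ₗ[R] M →ₗ[R] M)) (π : M →ₗ[R] M →ₗ[R] M)
    (a b : ℕ → M) : ℕ → M :=
  seriesMap φ (seriesMap₂ P a b) - cauchyProd π (seriesMap φ a) (seriesMap φ b)

/-- The coefficients of `morphismDefect` as bilinear maps. -/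
def morphismDefectCoeff (φ : ℕ → (M →ₗ[R] M)) (P : ℕ → (M →ₗ[R] M →ₗ[R] M))
    (π : M →ₗ[R] M →ₗ[R] M) (n : ℕ) : M →ₗ[R] M →ₗ[R] M :=
  LinearMap.mk₂ R (fun x y => morphismDefect φ P π (constSeries R x) (constSeries R y) n)
    (fun _ _ _ => by simp only [morphismDefect, map_add, LinearMap.add_apply, Pi.add_apply,
      Pi.sub_apply]; abel)
    (fun _ _ _ => by simp only [morphismDefect, map_smul, LinearMap.smul_apply, Pi.smul_apply,
      Pi.sub_apply, smul_sub])
    (fun _ _ _ => by simp only [morphismDefect, map_add, Pi.add_apply, Pi.sub_apply]; abel)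
    (fun _ _ _ => by simp only [morphismDefect, map_smul, Pi.smul_apply, Pi.sub_apply, smul_sub])

theorem morphismDefectCoeff_apply (φ : ℕ → (M →ₗ[R] M)) (P : ℕ → (M →ₗ[R] M →ₗ[R] M))
    (π : M →ₗ[R] M →ₗ[R] M) (n : ℕ) (x y : M) :
    morphismDefectCoeff φ P π n x y
      = morphismDefect φ P π (constSeries R x) (constSeries R y) n := rfl

theorem morphismDefectCoeff_eq_sum (φ : ℕ → (M →ₗ[R] M)) (P : ℕ → (M →ₗ[R] M →ₗ[R] M))
    (π : M →ₗ[R] M →ₗ[R] M) (n : ℕ) (x y : M) :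
    morphismDefectCoeff φ P π n x y
      = ∑ p ∈ antidiagonal n, φ p.1 (P p.2 x y)
        - ∑ p ∈ antidiagonal n, π (φ p.1 x) (φ p.2 y) := by
  simp [morphismDefectCoeff_apply, morphismDefect, seriesMap₂_apply,
    cauchyProd_apply LinearMap.id _ (cauchyProd _ _ _), cauchyProd_apply π]

theorem morphismDefect_apply_of_vanish {φ : ℕ → (M →ₗ[R] M)} {P : ℕ → (M →ₗ[R] M →ₗ[R] M)}
    {π : M →ₗ[R] M →ₗ[R] M} {n : ℕ} (h : ∀ k < n, morphismDefectCoeff φ P π k = 0)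
    {k : ℕ} (hk : k ≤ n) (a b : ℕ → M) :
    morphismDefect φ P π a b k = morphismDefectCoeff φ P π k (a 0) (b 0) := by
  have hb : ∀ x, ∀ k ≤ n, ∀ b, morphismDefect φ P π (constSeries R x) b k
      = morphismDefectCoeff φ P π k x (b 0) := fun x =>
    apply_eq_apply_constSeries (R := R) (fun b => morphismDefect φ P π (constSeries R x) b)
      (fun _ _ => by simp only [morphismDefect, map_add]; abel)
      (fun _ => by simp [morphismDefect, seriesMap₂_apply, shiftSeries_sub])
      (fun y k hk => by rw [← morphismDefectCoeff_apply, h k hk]; rfl)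
  rw [← hb _ k hk]
  exact apply_eq_apply_constSeries (R := R) (fun a => morphismDefect φ P π a b)
    (fun _ _ => by simp only [morphismDefect, map_add, LinearMap.add_apply]; abel)
    (fun _ => by simp [morphismDefect, seriesMap₂_apply, shiftSeries_sub])
    (fun y k hk => by rw [hb y k hk.le, h k hk]; rfl) k hk a

theorem seriesMap_seriesMap₂ (φ : ℕ → (M →ₗ[R] M)) (P : ℕ → (M →ₗ[R] M →ₗ[R] M))
    (π : M →ₗ[R] M →ₗ[R] M) (a b : ℕ → M) :
    seriesMap φ (seriesMap₂ P a b)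
      = cauchyProd π (seriesMap φ a) (seriesMap φ b) + morphismDefect φ P π a b := by
  simp [morphismDefect]

/-- The leading coefficients of the defects measure how far `φ` is from intertwining the
antisymmetrized associators. -/
theorem seriesMap_altAssoc {φ : ℕ → (M →ₗ[R] M)} (hφ : φ 0 = LinearMap.id)
    {P Q : ℕ → (M →ₗ[R] M →ₗ[R] M)} {n : ℕ}
    (hP : ∀ k < n, morphismDefectCoeff φ P (P 0) k = 0)
    (hQ : ∀ k < n, morphismDefectCoeff φ Q (Q 0) k = 0) (x y z : M) :
    seriesMap φ (altAssoc (seriesMap₂ P) (seriesMap₂ Q)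
        (constSeries R x) (constSeries R y) (constSeries R z)) n
      = altAssoc (cauchyProd (P 0)) (cauchyProd (Q 0)) (seriesMap φ (constSeries R x))
          (seriesMap φ (constSeries R y)) (seriesMap φ (constSeries R z)) n
        + (altAssoc (morphismDefectCoeff φ P (P 0) n) (Q 0) x y z
          + altAssoc (P 0) (morphismDefectCoeff φ Q (Q 0) n) x y z) := by
  have hvan : ∀ x y, ∀ k < n, morphismDefect φ Q (Q 0) (constSeries R x) (constSeries R y) k = 0 :=
    fun x y k hk => by rw [← morphismDefectCoeff_apply, hQ k hk]; rfl
  have hQ0 : ∀ x y, seriesMap₂ Q (constSeries R x) (constSeries R y) 0 = Q 0 x y := fun x y => by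
    simp [seriesMap₂_apply]
  have hleft : ∀ x y z, seriesMap φ (seriesMap₂ P (seriesMap₂ Q (constSeries R x)
      (constSeries R y)) (constSeries R z)) n
      = cauchyProd (P 0) (cauchyProd (Q 0) (seriesMap φ (constSeries R x))
          (seriesMap φ (constSeries R y))) (seriesMap φ (constSeries R z)) n
        + P 0 (morphismDefectCoeff φ Q (Q 0) n x y) z
        + morphismDefectCoeff φ P (P 0) n (Q 0 x y) z := fun x y z => by
    rw [seriesMap_seriesMap₂ φ P (P 0), seriesMap_seriesMap₂ φ Q (Q 0), Pi.add_apply,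
      morphismDefect_apply_of_vanish hP le_rfl, map_add, LinearMap.add_apply, Pi.add_apply,
      cauchyProd_apply_of_left_vanish _ _ (hvan x y), hQ0]
    simp [hφ, morphismDefectCoeff_apply]
  have hright : ∀ x y z, seriesMap φ (seriesMap₂ P (constSeries R x) (seriesMap₂ Q
      (constSeries R y) (constSeries R z))) n
      = cauchyProd (P 0) (seriesMap φ (constSeries R x)) (cauchyProd (Q 0)
          (seriesMap φ (constSeries R y)) (seriesMap φ (constSeries R z))) n
        + P 0 x (morphismDefectCoeff φ Q (Q 0) n y z)
        + morphismDefectCoeff φ P (P 0) n x (Q 0 y z) := fun x y z => by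
    rw [seriesMap_seriesMap₂ φ P (P 0), seriesMap_seriesMap₂ φ Q (Q 0), Pi.add_apply,
      morphismDefect_apply_of_vanish hP le_rfl, map_add, Pi.add_apply,
      cauchyProd_apply_of_right_vanish _ _ (hvan y z), hQ0]
    simp [hφ, morphismDefectCoeff_apply]
  simp only [altAssoc, map_add, map_sub, Pi.add_apply, Pi.sub_apply, hleft, hright]
  abel

theorem morphismDefectCoeff_congr {φ ψ : ℕ → (M →ₗ[R] M)} (P : ℕ → (M →ₗ[R] M →ₗ[R] M))
    (π : M →ₗ[R] M →ₗ[R] M) {n : ℕ} (h : ∀ k ≤ n, φ k = ψ k) :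
    morphismDefectCoeff φ P π n = morphismDefectCoeff ψ P π n := by
  ext x y
  rw [morphismDefectCoeff_eq_sum, morphismDefectCoeff_eq_sum]
  congr 1 <;> refine Finset.sum_congr rfl fun p hp => ?_ <;>
    rw [Finset.HasAntidiagonal.mem_antidiagonal] at hp
  · rw [h p.1 (by omega)]
  · rw [h p.1 (by omega), h p.2 (by omega)]

theorem morphismDefectCoeff_add_single {φ : ℕ → (M →ₗ[R] M)} (hφ : φ 0 = LinearMap.id)
    (P : ℕ → (M →ₗ[R] M →ₗ[R] M)) (ψ : M →ₗ[R] M) {n : ℕ} (hn : n ≠ 0) (x y : M) :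
    morphismDefectCoeff (φ + Pi.single n ψ) P (P 0) n x y
      = morphismDefectCoeff φ P (P 0) n x y
        - (P 0 (ψ x) y + P 0 x (ψ y) - ψ (P 0 x y)) := by
  have hs : ∀ k < n, (Pi.single n ψ : ℕ → (M →ₗ[R] M)) k = 0 := fun k hk =>
    Pi.single_eq_of_ne hk.ne _
  have hv : ∀ u, ∀ k < n, seriesMap (Pi.single n ψ) (constSeries R u) k = 0 := fun u k hk => by
    simp [hs k hk]
  simp only [morphismDefectCoeff_apply, morphismDefect, map_add, LinearMap.add_apply,
    Pi.add_apply, Pi.sub_apply, cauchyProd_apply_of_left_vanish _ _ hs,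
    cauchyProd_apply_of_left_vanish _ _ (hv x), cauchyProd_apply_of_right_vanish _ _ (hv y)]
  simp [seriesMap₂_apply, hφ, hs 0 (Nat.pos_of_ne_zero hn)]
  abel

end Series

/-- Dependent choice for sequences whose finite truncations can be extended one term at a time. -/
theorem exists_seq_of_extend {α : Type*} (p : ℕ → (ℕ → α) → Prop)
    (hcongr : ∀ n f f', (∀ k ≤ n, f k = f' k) → p n f → p n f')
    (h0 : ∃ f, p 0 f)
    (hstep : ∀ n f, p n f → ∃ f', p (n + 1) f' ∧ ∀ k ≤ n, f' k = f k) :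
    ∃ f, ∀ n, p n f := by
  obtain ⟨f₀, hf₀⟩ := h0
  choose! next hnext hagree using hstep
  let F : ℕ → ℕ → α := fun n => Nat.rec f₀ next n
  have hF : ∀ n, p n (F n) := fun n => by
    induction n with
    | zero => exact hf₀
    | succ n ih => exact hnext n _ ih
  have hstable : ∀ k m, F (k + m) k = F k k := fun k m => by
    induction m with
    | zero => rfl
    | succ m ih => exact (hagree (k + m) _ (hF _) k (by omega)).trans ih
  refine ⟨fun n => F n n, fun n => hcongr n (F n) _ (fun k hk => ?_) (hF n)⟩
  obtain ⟨m, rfl⟩ := Nat.exists_eq_add_of_le hk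
  exact hstable k m

theorem IsPreLie.altAssoc_eq_zero {π : g →ₗ[K] g →ₗ[K] g} (h : IsPreLie π) (x y z : g) :
    altAssoc π π x y z = 0 := by
  rw [altAssoc, h x y z]; abel

theorem IsCompatPair.altAssoc_add_swap {π₁ π₂ : g →ₗ[K] g →ₗ[K] g} (h : IsCompatPair π₁ π₂)
    (x y z : g) : altAssoc π₁ π₂ x y z + altAssoc π₂ π₁ x y z = 0 := by
  rw [← h x y z, altAssoc, altAssoc]; abel

section Deformation

variable {P₁ P₂ : ℕ → (g →ₗ[K] g →ₗ[K] g)}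

theorem IsFormalDeformation.altAssoc_fst (h : IsFormalDeformation P₁ P₂) (h₁ : IsPreLie (P₁ 0))
    (x y z : g) : altAssoc (seriesMap₂ P₁) (seriesMap₂ P₁)
      (constSeries K x) (constSeries K y) (constSeries K z) = 0 := by
  ext n
  rw [altAssoc_seriesMap₂_constSeries]
  rcases Nat.eq_zero_or_pos n with rfl | hn
  · simpa using h₁.altAssoc_eq_zero x y z
  · rw [Finset.Nat.sum_antidiagonal_eq_sum_range_succ
      (fun i j => altAssoc (P₁ i) (P₁ j) x y z)]
    exact (h n hn x y z).1

theorem IsFormalDeformation.altAssoc_snd (h : IsFormalDeformation P₁ P₂) (h₂ : IsPreLie (P₂ 0))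
    (x y z : g) : altAssoc (seriesMap₂ P₂) (seriesMap₂ P₂)
      (constSeries K x) (constSeries K y) (constSeries K z) = 0 := by
  ext n
  rw [altAssoc_seriesMap₂_constSeries]
  rcases Nat.eq_zero_or_pos n with rfl | hn
  · simpa using h₂.altAssoc_eq_zero x y z
  · rw [Finset.Nat.sum_antidiagonal_eq_sum_range_succ
      (fun i j => altAssoc (P₂ i) (P₂ j) x y z)]
    exact (h n hn x y z).2.1

theorem IsFormalDeformation.altAssoc_add_swap (h : IsFormalDeformation P₁ P₂)
    (h₃ : IsCompatPair (P₁ 0) (P₂ 0)) (x y z : g) :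
    altAssoc (seriesMap₂ P₁) (seriesMap₂ P₂)
        (constSeries K x) (constSeries K y) (constSeries K z)
      + altAssoc (seriesMap₂ P₂) (seriesMap₂ P₁)
        (constSeries K x) (constSeries K y) (constSeries K z) = 0 := by
  ext n
  rw [Pi.add_apply, altAssoc_seriesMap₂_constSeries, altAssoc_seriesMap₂_constSeries]
  rcases Nat.eq_zero_or_pos n with rfl | hn
  · simpa using h₃.altAssoc_add_swap x y z
  · rw [← Finset.Nat.sum_antidiagonal_swap (f := fun i => altAssoc (P₂ i.1) (P₁ i.2) x y z),
      ← Finset.sum_add_distrib]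
    simp only [Prod.fst_swap, Prod.snd_swap]
    rw [Finset.Nat.sum_antidiagonal_eq_sum_range_succ
      (fun i j => altAssoc (P₁ i) (P₂ j) x y z + altAssoc (P₂ j) (P₁ i) x y z)]
    refine Eq.trans (Finset.sum_congr rfl fun i _ => ?_) (h n hn x y z).2.2
    rw [altAssoc, altAssoc]; abel

variable {φ : ℕ → (g →ₗ[K] g)} {n : ℕ}

theorem cocycle1_morphismDefectCoeff (hφ : φ 0 = LinearMap.id) {P : ℕ → (g →ₗ[K] g →ₗ[K] g)}
    (h₀ : IsPreLie (P 0))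
    (h : ∀ x y z, altAssoc (seriesMap₂ P) (seriesMap₂ P)
      (constSeries K x) (constSeries K y) (constSeries K z) = 0)
    (hP : ∀ k < n, morphismDefectCoeff φ P (P 0) k = 0) :
    Cocycle1 (P 0) (fun x y => morphismDefectCoeff φ P (P 0) n x y) := by
  intro x y z
  have key := seriesMap_altAssoc hφ hP hP x y z
  rw [h, map_zero, altAssoc_cauchyProd_self _ h₀.altAssoc_eq_zero, Pi.zero_apply, zero_add] at key
  rw [key, altAssoc, altAssoc]; abel

theorem cocycleMixed_morphismDefectCoeff (hφ : φ 0 = LinearMap.id)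
    (h₃ : IsCompatPair (P₁ 0) (P₂ 0)) (h : IsFormalDeformation P₁ P₂)
    (hP₁ : ∀ k < n, morphismDefectCoeff φ P₁ (P₁ 0) k = 0)
    (hP₂ : ∀ k < n, morphismDefectCoeff φ P₂ (P₂ 0) k = 0) :
    CocycleMixed (P₁ 0) (P₂ 0) (fun x y => morphismDefectCoeff φ P₁ (P₁ 0) n x y)
      (fun x y => morphismDefectCoeff φ P₂ (P₂ 0) n x y) := by
  intro x y z
  have hl := congrArg (fun a => seriesMap φ a n) (h.altAssoc_add_swap h₃ x y z)
  have hr := congrFun (altAssoc_cauchyProd_add_swap _ _ h₃.altAssoc_add_swap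
    (seriesMap φ (constSeries K x)) (seriesMap φ (constSeries K y))
    (seriesMap φ (constSeries K z))) n
  simp only [map_add, map_zero, Pi.add_apply, Pi.zero_apply] at hl hr
  rw [seriesMap_altAssoc hφ hP₁ hP₂, seriesMap_altAssoc hφ hP₂ hP₁, add_add_add_comm, hr,
    zero_add] at hl
  rw [← hl]
  simp only [altAssoc]; abel

end Deformation

/-- if the second cohomology with coefficients in the regular
representation vanishes (every 2-cocycle is a coboundary), then the compatible
pre-Lie algebra is rigid: every 1-parameter formal deformation is trivial. -/
theorem rigidity_of_compatible_preLie
    (π₁ π₂ : g →ₗ[K] g →ₗ[K] g)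
    (h₁ : IsPreLie π₁) (h₂ : IsPreLie π₂) (h₃ : IsCompatPair π₁ π₂)
    (hH2 : ∀ ω₁ ω₂ : g →ₗ[K] g →ₗ[K] g,
      Cocycle1 π₁ (fun x y => ω₁ x y) →
      Cocycle1 π₂ (fun x y => ω₂ x y) →
      CocycleMixed π₁ π₂ (fun x y => ω₁ x y) (fun x y => ω₂ x y) →
      ∃ φ : g →ₗ[K] g, ∀ x y : g,
        ω₁ x y = π₁ (φ x) y + π₁ x (φ y) - φ (π₁ x y) ∧
        ω₂ x y = π₂ (φ x) y + π₂ x (φ y) - φ (π₂ x y)) :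
    ∀ P₁ P₂ : ℕ → (g →ₗ[K] g →ₗ[K] g),
      P₁ 0 = π₁ → P₂ 0 = π₂ → IsFormalDeformation P₁ P₂ →
      ∃ φ : ℕ → (g →ₗ[K] g),
        φ 0 = LinearMap.id ∧
        (∀ (n : ℕ) (x y : g),
          (∑ i ∈ Finset.range (n + 1), φ i (P₁ (n - i) x y))
            = ∑ i ∈ Finset.range (n + 1), π₁ (φ i x) (φ (n - i) y)) ∧
        (∀ (n : ℕ) (x y : g),
          (∑ i ∈ Finset.range (n + 1), φ i (P₂ (n - i) x y))
            = ∑ i ∈ Finset.range (n + 1), π₂ (φ i x) (φ (n - i) y)) := by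
  rintro P₁ P₂ rfl rfl hdef
  obtain ⟨φ, hφ⟩ := exists_seq_of_extend
    (fun n (φ : ℕ → (g →ₗ[K] g)) => φ 0 = LinearMap.id ∧ ∀ k ≤ n,
      morphismDefectCoeff φ P₁ (P₁ 0) k = 0 ∧ morphismDefectCoeff φ P₂ (P₂ 0) k = 0)
    (fun n f f' hff ⟨hf, h⟩ => ⟨by rw [← hff 0 (Nat.zero_le n), hf], fun k hk => by
      have hk' : ∀ i ≤ k, f i = f' i := fun i hi => hff i (hi.trans hk)
      rw [← morphismDefectCoeff_congr _ _ hk', ← morphismDefectCoeff_congr _ _ hk']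
      exact h k hk⟩)
    ⟨fun _ => LinearMap.id, rfl, fun k hk => by
      obtain rfl := Nat.le_zero.1 hk
      constructor <;> ext x y <;> simp [morphismDefectCoeff_eq_sum]⟩
    (fun n φ ⟨hφ, h⟩ => by
      have hlt₁ : ∀ k < n + 1, morphismDefectCoeff φ P₁ (P₁ 0) k = 0 :=
        fun k hk => (h k (Nat.lt_succ_iff.1 hk)).1
      have hlt₂ : ∀ k < n + 1, morphismDefectCoeff φ P₂ (P₂ 0) k = 0 :=
        fun k hk => (h k (Nat.lt_succ_iff.1 hk)).2
      obtain ⟨ψ, hψ⟩ := hH2 _ _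
        (cocycle1_morphismDefectCoeff hφ h₁ (hdef.altAssoc_fst h₁) hlt₁)
        (cocycle1_morphismDefectCoeff hφ h₂ (hdef.altAssoc_snd h₂) hlt₂)
        (cocycleMixed_morphismDefectCoeff hφ h₃ hdef hlt₁ hlt₂)
      have hagree : ∀ k ≤ n, (φ + Pi.single (n + 1) ψ : ℕ → (g →ₗ[K] g)) k = φ k := fun k hk => by
        simp [Pi.single_eq_of_ne (show k ≠ n + 1 by omega)]
      refine ⟨φ + Pi.single (n + 1) ψ, ⟨by rw [hagree 0 (Nat.zero_le n), hφ], fun k hk => ?_⟩,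
        hagree⟩
      rcases Nat.le_succ_iff.1 hk with hk | rfl
      · have hk' : ∀ i ≤ k, (φ + Pi.single (n + 1) ψ : ℕ → (g →ₗ[K] g)) i = φ i :=
          fun i hi => hagree i (hi.trans hk)
        rw [morphismDefectCoeff_congr _ _ hk', morphismDefectCoeff_congr _ _ hk']
        exact h k hk
      · constructor <;> ext x y <;>
          rw [morphismDefectCoeff_add_single hφ _ _ n.succ_ne_zero]
        · rw [(hψ x y).1, sub_self]; rfl
        · rw [(hψ x y).2, sub_self]; rfl)
  have hcoeff : ∀ P : ℕ → (g →ₗ[K] g →ₗ[K] g), ∀ n x y,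
      morphismDefectCoeff φ P (P 0) n = 0 →
      ∑ i ∈ Finset.range (n + 1), φ i (P (n - i) x y)
        = ∑ i ∈ Finset.range (n + 1), P 0 (φ i x) (φ (n - i) y) := fun P n x y h => by
    have hxy := morphismDefectCoeff_eq_sum φ P (P 0) n x y
    rw [h, LinearMap.zero_apply, LinearMap.zero_apply, eq_comm, sub_eq_zero,
      Finset.Nat.sum_antidiagonal_eq_sum_range_succ (fun i j => φ i (P j x y)),
      Finset.Nat.sum_antidiagonal_eq_sum_range_succ (fun i j => P 0 (φ i x) (φ j y))] at hxy
    exact hxy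
  exact ⟨φ, (hφ 0).1, fun n x y => hcoeff P₁ n x y ((hφ n).2 n le_rfl).1,
    fun n x y => hcoeff P₂ n x y ((hφ n).2 n le_rfl).2⟩
end
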